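/- arXiv:2407.13380 — 2 statements merged into one kernel-verified Lean document; each statement's English description precedes it below -/
import Mathlib

section
/- Let U_C, U_W, U_E, U_S, U_N ∈ G be five 2D Euler states. Let α_W ≥ max{|v₁(U_W)|+a(U_W), |v₁(U_C)|+a(U_C)}, α_E ≥ max{|v₁(U_C)|+a(U_C), |v₁(U_E)|+a(U_E)}, α_S ≥ max{|v₂(U_S)|+a(U_S), |v₂(U_C)|+a(U_C)}, α_N ≥ max{|v₂(U_C)|+a(U_C), |v₂(U_N)|+a(U_N)}, all positive. Let Δt, Δx, Δy > 0 with Δt ≤ ½ min{Δx/(α_W + α_E), Δy/(α_S + α_N)} and μ₁ = Δt/Δx, μ₂ = Δt/Δy. Then the first-order LLF update Ū' = U_C − μ₁(F̂_E − F̂_W) − μ₂(F̂_N − F̂_S), with F̂_E = ½(F₁(U_C)+F₁(U_E)) − (α_E/2)(U_E − U_C), F̂_W = ½(F₁(U_W)+F₁(U_C)) − (α_W/2)(U_C − U_W), F̂_N = ½(F₂(U_C)+F₂(U_N)) − (α_N/2)(U_N − U_C), F̂_S = ½(F₂(U_S)+F₂(U_C)) − (α_S/2)(U_C − U_S), belongs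 to G, i.e. has positive density and positive pressure. -/
noncomputable section

/-- Perfect-gas pressure of a 2D Euler conservative state `U = (ρ, m₁, m₂, E)`. -/
def eulerPressure (γ : ℝ) (U : Fin 4 → ℝ) : ℝ :=
  (γ - 1) * (U 3 - ((U 1) ^ 2 + (U 2) ^ 2) / (2 * U 0))

/-- x-directional Euler flux. -/
def eulerFlux1 (γ : ℝ) (U : Fin 4 → ℝ) : Fin 4 → ℝ :=
  ![U 1, (U 1) ^ 2 / U 0 + eulerPressure γ U, U 1 * U 2 / U 0,
    (U 3 + eulerPressure γ U) * (U 1 / U 0)]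

/-- y-directional Euler flux. -/
def eulerFlux2 (γ : ℝ) (U : Fin 4 → ℝ) : Fin 4 → ℝ :=
  ![U 2, U 1 * U 2 / U 0, (U 2) ^ 2 / U 0 + eulerPressure γ U,
    (U 3 + eulerPressure γ U) * (U 2 / U 0)]

/-- Sound speed. -/
def soundSpeed (γ : ℝ) (U : Fin 4 → ℝ) : ℝ :=
  Real.sqrt (γ * eulerPressure γ U / U 0)

/-- Admissible state set: positive density and pressure. -/
def eulerAdmissible (γ : ℝ) : Set (Fin 4 → ℝ) :=
  {U | 0 < U 0 ∧ 0 < eulerPressure γ U}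

/-- Admissibility as a family of strict inequalities that are linear in the state. -/
theorem mem_eulerAdmissible_iff {γ : ℝ} (hγ : 1 < γ) (U : Fin 4 → ℝ) :
    U ∈ eulerAdmissible γ ↔
      0 < U 0 ∧ ∀ a b : ℝ, 0 < U 3 - U 1 * a - U 2 * b + U 0 * ((a ^ 2 + b ^ 2) / 2) := by
  refine and_congr_right fun h0 => ?_
  rw [eulerPressure, mul_pos_iff_of_pos_left (sub_pos.2 hγ)]
  have key (a b : ℝ) : U 3 - U 1 * a - U 2 * b + U 0 * ((a ^ 2 + b ^ 2) / 2) =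
      (U 3 - (U 1 ^ 2 + U 2 ^ 2) / (2 * U 0)) +
        U 0 * (((a - U 1 / U 0) ^ 2 + (b - U 2 / U 0) ^ 2) / 2) := by
    field_simp
    ring
  constructor
  · intro h a b
    rw [key]
    positivity
  · intro h
    simpa [key] using h (U 1 / U 0) (U 2 / U 0)

theorem add_mem_eulerAdmissible {γ : ℝ} (hγ : 1 < γ) {U V : Fin 4 → ℝ}
    (hU : U ∈ eulerAdmissible γ) (hV : V ∈ eulerAdmissible γ) :
    U + V ∈ eulerAdmissible γ := by
  rw [mem_eulerAdmissible_iff hγ] at *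
  refine ⟨add_pos hU.1 hV.1, fun a b => ?_⟩
  simp only [Pi.add_apply]
  linarith [hU.2 a b, hV.2 a b]

theorem smul_mem_eulerAdmissible {γ : ℝ} (hγ : 1 < γ) {U : Fin 4 → ℝ}
    (hU : U ∈ eulerAdmissible γ) {c : ℝ} (hc : 0 < c) : c • U ∈ eulerAdmissible γ := by
  rw [mem_eulerAdmissible_iff hγ] at *
  refine ⟨mul_pos hc hU.1, fun a b => ?_⟩
  simp only [Pi.smul_apply, smul_eq_mul]
  linarith [mul_pos hc (hU.2 a b)]

/-- Exchanging the two momentum components preserves admissibility. -/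
theorem swap_mem_eulerAdmissible {γ : ℝ} {U : Fin 4 → ℝ} (hU : U ∈ eulerAdmissible γ) :
    ![U 0, U 2, U 1, U 3] ∈ eulerAdmissible γ := by
  simpa [eulerAdmissible, eulerPressure, add_comm] using hU

theorem smul_add_smul_eulerFlux1_mem {γ : ℝ} (hγ : 1 < γ) {U : Fin 4 → ℝ}
    (hU : U ∈ eulerAdmissible γ) {α ε : ℝ} (hε : |ε| = 1)
    (hα : |U 1 / U 0| + soundSpeed γ U ≤ α) :
    α • U + ε • eulerFlux1 γ U ∈ eulerAdmissible γ := by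
  obtain ⟨h0, hp⟩ := hU
  have hε2 : ε ^ 2 = 1 := by rw [← sq_abs, hε, one_pow]
  have hsound : 0 < γ * eulerPressure γ U / U 0 := by positivity
  have hs : soundSpeed γ U ≤ α + ε * (U 1 / U 0) := by
    have := neg_abs_le (ε * (U 1 / U 0))
    rw [abs_mul, hε, one_mul] at this
    linarith
  have ha : 0 < soundSpeed γ U := Real.sqrt_pos.2 hsound
  have hsq : γ * eulerPressure γ U / U 0 ≤ (α + ε * (U 1 / U 0)) ^ 2 := by
    rw [← Real.sq_sqrt hsound.le]
    exact pow_le_pow_left₀ ha.le hs 2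
  have hspos := ha.trans_le hs
  have hE : U 3 = eulerPressure γ U / (γ - 1) + (U 1 ^ 2 + U 2 ^ 2) / (2 * U 0) := by
    have : γ - 1 ≠ 0 := (sub_pos.2 hγ).ne'
    rw [eulerPressure]
    field_simp
    ring
  generalize hP : eulerPressure γ U = p at *
  generalize hS : α + ε * (U 1 / U 0) = s at *
  have hαs : α = s - ε * (U 1 / U 0) := by linarith
  have hρ : (α • U + ε • eulerFlux1 γ U) 0 = s * U 0 := by
    simp [eulerFlux1, hαs]
    field_simp
    ring
  have hpres : eulerPressure γ (α • U + ε • eulerFlux1 γ U) =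
      (γ - 1) * (s * (p / (γ - 1)) - p ^ 2 / (2 * (s * U 0))) := by
    have hγ' : γ - 1 ≠ 0 := (sub_pos.2 hγ).ne'
    rw [eulerPressure, hρ]
    have h1 : (α • U + ε • eulerFlux1 γ U) 1 = s * U 1 + ε * p := by
      simp [eulerFlux1, hαs, hP]
      field_simp
      ring
    have h2 : (α • U + ε • eulerFlux1 γ U) 2 = s * U 2 := by
      simp [eulerFlux1, hαs]
      field_simp
      ring
    have h3 : (α • U + ε • eulerFlux1 γ U) 3 = s * U 3 + ε * p * (U 1 / U 0) := by
      simp [eulerFlux1, hαs, hP]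
      field_simp
      ring
    rw [h1, h2, h3, hE]
    have hsq' : (s * U 1 + ε * p) ^ 2 = s ^ 2 * U 1 ^ 2 + 2 * s * U 1 * ε * p + p ^ 2 := by
      linear_combination p ^ 2 * hε2
    rw [hsq']
    field_simp
    ring
  refine ⟨by rw [hρ]; positivity, ?_⟩
  have hγ0 : 0 < γ - 1 := sub_pos.2 hγ
  rw [hpres]
  refine mul_pos hγ0 (sub_pos.2 ?_)
  rw [div_le_iff₀ h0] at hsq
  rw [← mul_div_assoc, div_lt_div_iff₀ (by positivity) hγ0]
  nlinarith [mul_le_mul_of_nonneg_left hsq hp.le, mul_pos hp hp]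

theorem smul_add_smul_eulerFlux2_mem {γ : ℝ} (hγ : 1 < γ) {U : Fin 4 → ℝ}
    (hU : U ∈ eulerAdmissible γ) {α ε : ℝ} (hε : |ε| = 1)
    (hα : |U 2 / U 0| + soundSpeed γ U ≤ α) :
    α • U + ε • eulerFlux2 γ U ∈ eulerAdmissible γ := by
  have hp : eulerPressure γ ![U 0, U 2, U 1, U 3] = eulerPressure γ U := by
    simp [eulerPressure, add_comm]
  have h := swap_mem_eulerAdmissible (smul_add_smul_eulerFlux1_mem hγ
    (swap_mem_eulerAdmissible hU) hε (by simpa [soundSpeed, hp] using hα))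
  convert h using 1
  ext i
  fin_cases i <;> simp [eulerFlux1, eulerFlux2, hp, mul_comm (U 1)]

theorem llf_scheme_2d_euler_BP
    (γ : ℝ) (hγ : 1 < γ)
    (UC UW UE US UN : Fin 4 → ℝ)
    (hC : UC ∈ eulerAdmissible γ) (hW : UW ∈ eulerAdmissible γ)
    (hE : UE ∈ eulerAdmissible γ) (hS : US ∈ eulerAdmissible γ)
    (hN : UN ∈ eulerAdmissible γ)
    (αW αE αS αN : ℝ) (hαW : 0 < αW) (hαE : 0 < αE) (hαS : 0 < αS) (hαN : 0 < αN)
    (hbW : max (|UW 1 / UW 0| + soundSpeed γ UW) (|UC 1 / UC 0| + soundSpeed γ UC) ≤ αW)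
    (hbE : max (|UC 1 / UC 0| + soundSpeed γ UC) (|UE 1 / UE 0| + soundSpeed γ UE) ≤ αE)
    (hbS : max (|US 2 / US 0| + soundSpeed γ US) (|UC 2 / UC 0| + soundSpeed γ UC) ≤ αS)
    (hbN : max (|UC 2 / UC 0| + soundSpeed γ UC) (|UN 2 / UN 0| + soundSpeed γ UN) ≤ αN)
    (Δt Δx Δy : ℝ) (hΔt : 0 < Δt) (hΔx : 0 < Δx) (hΔy : 0 < Δy)
    (hcfl : Δt ≤ (1 / 2) * min (Δx / (αW + αE)) (Δy / (αS + αN))) :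
    let μ₁ := Δt / Δx
    let μ₂ := Δt / Δy
    let FE := (1 / 2 : ℝ) • (eulerFlux1 γ UC + eulerFlux1 γ UE) - (αE / 2) • (UE - UC)
    let FW := (1 / 2 : ℝ) • (eulerFlux1 γ UW + eulerFlux1 γ UC) - (αW / 2) • (UC - UW)
    let FN := (1 / 2 : ℝ) • (eulerFlux2 γ UC + eulerFlux2 γ UN) - (αN / 2) • (UN - UC)
    let FS := (1 / 2 : ℝ) • (eulerFlux2 γ US + eulerFlux2 γ UC) - (αS / 2) • (UC - US)
    UC - μ₁ • (FE - FW) - μ₂ • (FN - FS) ∈ eulerAdmissible γ := by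
  intro μ₁ μ₂ FE FW FN FS
  have hμ₁ : 0 < μ₁ := div_pos hΔt hΔx
  have hμ₂ : 0 < μ₂ := div_pos hΔt hΔy
  have hx : μ₁ * (αW + αE) ≤ 1 / 2 := by
    have h := hcfl.trans (mul_le_mul_of_nonneg_left (min_le_left _ _) (by norm_num))
    rw [← mul_div_assoc, le_div_iff₀ (by positivity)] at h
    rwa [div_mul_eq_mul_div, div_le_iff₀ hΔx]
  have hy : μ₂ * (αS + αN) ≤ 1 / 2 := by
    have h := hcfl.trans (mul_le_mul_of_nonneg_left (min_le_right _ _) (by norm_num))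
    rw [← mul_div_assoc, le_div_iff₀ (by positivity)] at h
    rwa [div_mul_eq_mul_div, div_le_iff₀ hΔy]
  have hdecomp : UC - μ₁ • (FE - FW) - μ₂ • (FN - FS) =
      (1 - μ₁ * (αW + αE) / 2 - μ₂ * (αS + αN) / 2) • UC
        + (μ₁ / 2) • (αE • UE + (-1 : ℝ) • eulerFlux1 γ UE)
        + (μ₁ / 2) • (αW • UW + (1 : ℝ) • eulerFlux1 γ UW)
        + (μ₂ / 2) • (αN • UN + (-1 : ℝ) • eulerFlux2 γ UN)
        + (μ₂ / 2) • (αS • US + (1 : ℝ) • eulerFlux2 γ US) := by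
    simp only [FE, FW, FN, FS]
    module
  rw [hdecomp]
  have hadd {U V : Fin 4 → ℝ} := add_mem_eulerAdmissible hγ (U := U) (V := V)
  have hsmul {U : Fin 4 → ℝ} (hU : U ∈ eulerAdmissible γ) {c : ℝ} (hc : 0 < c) :=
    smul_mem_eulerAdmissible hγ hU hc
  refine hadd (hadd (hadd (hadd (hsmul hC (by linarith)) (hsmul ?_ (half_pos hμ₁)))
    (hsmul ?_ (half_pos hμ₁))) (hsmul ?_ (half_pos hμ₂))) (hsmul ?_ (half_pos hμ₂))
  · exact smul_add_smul_eulerFlux1_mem hγ hE (by simp) ((le_max_right _ _).trans hbE)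
  · exact smul_add_smul_eulerFlux1_mem hγ hW (by simp) ((le_max_left _ _).trans hbW)
  · exact smul_add_smul_eulerFlux2_mem hγ hN (by simp) ((le_max_right _ _).trans hbN)
  · exact smul_add_smul_eulerFlux2_mem hγ hS (by simp) ((le_max_left _ _).trans hbS)
end
end

section
/- Let f₁, f₂ : ℝ → ℝ be differentiable, m₀ ≤ M₀, and let u_C, u_W, u_E, u_S, u_N ∈ [m₀, M₀] be point values at a node and its four neighboring interface points. Let α_W, α_E > 0 bound |f₁'| on [m₀, M₀] and α_S, α_N > 0 bound |f₂'| on [m₀, M₀]. Let Δt > 0 and h₁, h₂ > 0 (with h₁ = (Δx_i + Δx_{i+1})/2 and h₂ = (Δy_j + Δy_{j+1})/2) satisfy Δt ≤ ½ min{h₁/(α_W + α_E), h₂/(α_S + α_N)}. Then the first-order LLF node update u' = u_C − (Δt/h₁)(f̂_E − f̂_W) − (Δt/h₂)(f̂_N − f̂_S), with f̂_E = ½(f₁(u_C)+f₁(u_E)) − (α_E/2)(u_E − u_C), f̂_W = ½(f₁(u_W)+f₁(u_C)) − (α_W/2)(u_C − u_W), f̂_N = ½(f₂(u_C)+f₂(u_N))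 − (α_N/2)(u_N − u_C), f̂_S = ½(f₂(u_S)+f₂(u_C)) − (α_S/2)(u_C − u_S), satisfies m₀ ≤ u' ≤ M₀. -/
/-- The mean value inequality for a function whose derivative is bounded on an interval. -/
lemma abs_sub_le_of_abs_deriv_le_Icc {f : ℝ → ℝ} (hf : Differentiable ℝ f) {m M α : ℝ}
    (hb : ∀ u ∈ Set.Icc m M, |deriv f u| ≤ α) {a b : ℝ}
    (ha : a ∈ Set.Icc m M) (hb' : b ∈ Set.Icc m M) : |f b - f a| ≤ α * |b - a| :=
  (convex_Icc m M).norm_image_sub_le_of_norm_deriv_le (fun x _ => hf x) hb ha hb'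

/-- Half of a jump with slope at most `α`, plus the matching upwinding term, stays within `α` times
the distance to the ends of the interval. -/
lemma half_add_half_mul_mem_Icc {m M α a b d : ℝ} (hα : 0 ≤ α)
    (hb : b ∈ Set.Icc m M) (ha : a ∈ Set.Icc m M) (hd : |d| ≤ α * |b - a|) :
    d / 2 + α / 2 * (b - a) ∈ Set.Icc (-(α * (a - m))) (α * (M - a)) := by
  obtain ⟨hd₁, hd₂⟩ := abs_le.mp hd
  have hlo := mul_le_mul_of_nonneg_left hb.1 hα
  have hhi := mul_le_mul_of_nonneg_left hb.2 hα
  have hlo' := mul_le_mul_of_nonneg_left ha.1 hα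
  have hhi' := mul_le_mul_of_nonneg_left ha.2 hα
  rcases abs_cases (b - a) with ⟨h, -⟩ | ⟨h, -⟩ <;> rw [h] at hd₁ hd₂ <;>
    constructor <;> linarith

/-- Under the half CFL condition, the local Lax–Friedrichs flux difference in one direction moves
the nodal value by at most half of its distance to the ends of the interval. -/
lemma llf_flux_difference_mem_Icc {f : ℝ → ℝ} (hf : Differentiable ℝ f) {m M a l r αl αr Δt h : ℝ}
    (ha : a ∈ Set.Icc m M) (hl : l ∈ Set.Icc m M) (hr : r ∈ Set.Icc m M)
    (hαl : 0 < αl) (hαr : 0 < αr)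
    (hbl : ∀ u ∈ Set.Icc m M, |deriv f u| ≤ αl) (hbr : ∀ u ∈ Set.Icc m M, |deriv f u| ≤ αr)
    (hΔt : 0 < Δt) (hh : 0 < h) (hcfl : Δt ≤ 1 / 2 * (h / (αl + αr))) :
    Δt / h * (((f a + f r) / 2 - αr / 2 * (r - a)) - ((f l + f a) / 2 - αl / 2 * (a - l))) ∈
      Set.Icc (-((M - a) / 2)) ((a - m) / 2) := by
  have hlam : 0 ≤ Δt / h := by positivity
  have hcourant : Δt / h * (αl + αr) ≤ 1 / 2 := by
    calc Δt / h * (αl + αr) ≤ 1 / 2 * (h / (αl + αr)) / h * (αl + αr) := by gcongr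
      _ = 1 / 2 := by field_simp
  have hjl := half_add_half_mul_mem_Icc hαl.le hl ha (abs_sub_le_of_abs_deriv_le_Icc hf hbl ha hl)
  have hjr := half_add_half_mul_mem_Icc hαr.le hr ha
    (d := -(f r - f a)) (by rw [abs_neg]; exact abs_sub_le_of_abs_deriv_le_Icc hf hbr ha hr)
  have hsum := add_le_add hjl.1 hjr.1
  have hsum' := add_le_add hjl.2 hjr.2
  have hlo := mul_le_mul_of_nonneg_left hsum hlam
  have hhi := mul_le_mul_of_nonneg_left hsum' hlam
  have hm := mul_le_mul_of_nonneg_right hcourant (sub_nonneg.mpr ha.1)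
  have hM := mul_le_mul_of_nonneg_right hcourant (sub_nonneg.mpr ha.2)
  constructor <;> linarith

theorem llf_node_update_scalar_MP
    (f₁ f₂ : ℝ → ℝ) (hf₁ : Differentiable ℝ f₁) (hf₂ : Differentiable ℝ f₂)
    (m₀ M₀ : ℝ) (hm : m₀ ≤ M₀)
    (uC uW uE uS uN : ℝ)
    (hC : uC ∈ Set.Icc m₀ M₀) (hW : uW ∈ Set.Icc m₀ M₀) (hE : uE ∈ Set.Icc m₀ M₀)
    (hS : uS ∈ Set.Icc m₀ M₀) (hN : uN ∈ Set.Icc m₀ M₀)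
    (αW αE αS αN : ℝ) (hαW : 0 < αW) (hαE : 0 < αE) (hαS : 0 < αS) (hαN : 0 < αN)
    (hbW : ∀ u ∈ Set.Icc m₀ M₀, |deriv f₁ u| ≤ αW)
    (hbE : ∀ u ∈ Set.Icc m₀ M₀, |deriv f₁ u| ≤ αE)
    (hbS : ∀ u ∈ Set.Icc m₀ M₀, |deriv f₂ u| ≤ αS)
    (hbN : ∀ u ∈ Set.Icc m₀ M₀, |deriv f₂ u| ≤ αN)
    (Δt Δxi Δxip Δyj Δyjp h₁ h₂ : ℝ)
    (hΔt : 0 < Δt) (hΔxi : 0 < Δxi) (hΔxip : 0 < Δxip)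
    (hΔyj : 0 < Δyj) (hΔyjp : 0 < Δyjp)
    (hh₁ : h₁ = (Δxi + Δxip) / 2) (hh₂ : h₂ = (Δyj + Δyjp) / 2)
    (hcfl : Δt ≤ (1 / 2) * min (h₁ / (αW + αE)) (h₂ / (αS + αN))) :
    let fE := (f₁ uC + f₁ uE) / 2 - αE / 2 * (uE - uC)
    let fW := (f₁ uW + f₁ uC) / 2 - αW / 2 * (uC - uW)
    let fN := (f₂ uC + f₂ uN) / 2 - αN / 2 * (uN - uC)
    let fS := (f₂ uS + f₂ uC) / 2 - αS / 2 * (uC - uS)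
    uC - Δt / h₁ * (fE - fW) - Δt / h₂ * (fN - fS) ∈ Set.Icc m₀ M₀ := by
  intro fE fW fN fS
  have hh₁pos : 0 < h₁ := by rw [hh₁]; positivity
  have hh₂pos : 0 < h₂ := by rw [hh₂]; positivity
  have hx := llf_flux_difference_mem_Icc hf₁ hC hW hE hαW hαE hbW hbE hΔt hh₁pos
    (hcfl.trans (by gcongr; exact min_le_left _ _))
  have hy := llf_flux_difference_mem_Icc hf₂ hC hS hN hαS hαN hbS hbN hΔt hh₂pos
    (hcfl.trans (by gcongr; exact min_le_right _ _))
  change Δt / h₁ * (fE - fW) ∈ _ at hx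
  change Δt / h₂ * (fN - fS) ∈ _ at hy
  exact ⟨by linarith [hx.2, hy.2], by linarith [hx.1, hy.1]⟩
end
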